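/- arXiv:math/0512186 — 3 statements merged into one kernel-verified Lean document; each statement's English description precedes it below -/
import Mathlib

section
/- Let n ≥ 2 and let A, B be n×n integer matrices. Then the pair (A,B) generates M_n(ℤ) if and only if the ℤ-linear span of the set of all matrices w(A,B), where w ranges over the nonempty words of length at most n²−1 in two letters, is all of M_n(ℤ). -/
/-- A pair `(A, B)` of `n × n` matrices over a commutative ring `R` generates `M_n(R)`
if the non-unital `R`-subalgebra of `M_n(R)` generated by `A` and `B` is all of `M_n(R)`. -/
def Generates {n : ℕ} (R : Type*) [CommRing R] (A B : Matrix (Fin n) (Fin n) R) : Prop :=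
  NonUnitalAlgebra.adjoin R ({A, B} : Set (Matrix (Fin n) (Fin n) R)) = ⊤

/-- The set of all matrices `w(A,B)` for nonempty words `w` of length at most `m`
in the two letters `A`, `B`: a word is a nonempty list over `Fin 2`, evaluated by
substituting `A` for `0` and `B` for `1` and taking the product. -/
def wordValues {n : ℕ} {R : Type*} [CommRing R] (A B : Matrix (Fin n) (Fin n) R) (m : ℕ) :
    Set (Matrix (Fin n) (Fin n) R) :=
  { M | ∃ w : List (Fin 2), w ≠ [] ∧ w.length ≤ m ∧
      (w.map fun i => if i = 0 then A else B).prod = M }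

section Words

variable {n : ℕ} {R : Type*} [CommRing R] (A B : Matrix (Fin n) (Fin n) R)

theorem wordValues_mono {m k : ℕ} (h : m ≤ k) : wordValues A B m ⊆ wordValues A B k := by
  rintro _ ⟨w, hw, hl, rfl⟩
  exact ⟨w, hw, hl.trans h, rfl⟩

theorem pair_subset_wordValues {m : ℕ} (hm : 1 ≤ m) : {A, B} ⊆ wordValues A B m := by
  rintro _ (rfl | rfl)
  · exact ⟨[0], by simp, by simpa using hm, by simp⟩
  · exact ⟨[1], by simp, by simpa using hm, by simp⟩

theorem mul_mem_wordValues_succ {m : ℕ} {X Y : Matrix (Fin n) (Fin n) R}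
    (hX : X ∈ ({A, B} : Set (Matrix (Fin n) (Fin n) R))) (hY : Y ∈ wordValues A B m) :
    X * Y ∈ wordValues A B (m + 1) := by
  obtain ⟨w, -, hl, rfl⟩ := hY
  rcases hX with rfl | rfl
  · exact ⟨0 :: w, by simp, by simpa using hl, by simp⟩
  · exact ⟨1 :: w, by simp, by simpa using hl, by simp⟩

theorem wordValues_subset_adjoin (m : ℕ) :
    wordValues A B m ⊆ NonUnitalAlgebra.adjoin R ({A, B} : Set (Matrix (Fin n) (Fin n) R)) := by
  have key : ∀ i : Fin 2, (if i = 0 then A else B) ∈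
      NonUnitalAlgebra.adjoin R ({A, B} : Set (Matrix (Fin n) (Fin n) R)) := by
    intro i
    apply NonUnitalAlgebra.subset_adjoin
    split_ifs <;> simp
  rintro _ ⟨w, hw, -, rfl⟩
  induction w with
  | nil => exact absurd rfl hw
  | cons i w ih =>
    rw [List.map_cons, List.prod_cons]
    by_cases hw' : w = []
    · simpa [hw'] using key i
    · exact mul_mem (key i) (ih hw')

/-- If words of length `m + 1` contribute nothing new to the span of the words of length at most
`m`, then this span contains the whole subalgebra generated by the pair. -/
theorem mem_span_wordValues_of_mem_adjoin {m : ℕ} (hm : 1 ≤ m)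
    (h : Submodule.span R (wordValues A B (m + 1)) ≤ Submodule.span R (wordValues A B m))
    {X : Matrix (Fin n) (Fin n) R}
    (hX : X ∈ NonUnitalAlgebra.adjoin R ({A, B} : Set (Matrix (Fin n) (Fin n) R))) :
    X ∈ Submodule.span R (wordValues A B m) := by
  set T := Submodule.span R (wordValues A B m) with hT
  have hmul : ∀ X ∈ ({A, B} : Set (Matrix (Fin n) (Fin n) R)), ∀ Y ∈ T, X * Y ∈ T := by
    intro X hX Y hY
    induction hY using Submodule.span_induction with
    | mem Y hY => exact h (Submodule.subset_span (mul_mem_wordValues_succ A B hX hY))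
    | zero => simp
    | add Y Z _ _ hY hZ => rw [mul_add]; exact add_mem hY hZ
    | smul r Y _ hY => rw [mul_smul_comm]; exact T.smul_mem r hY
  suffices X ∈ T ∧ ∀ Y ∈ T, X * Y ∈ T from this.1
  induction hX using NonUnitalAlgebra.adjoin_induction with
  | mem X hX => exact ⟨Submodule.subset_span (pair_subset_wordValues A B hm hX), hmul X hX⟩
  | zero => simp
  | add X Y _ _ hX hY =>
    exact ⟨add_mem hX.1 hY.1, fun Z hZ => by
      rw [add_mul]; exact add_mem (hX.2 Z hZ) (hY.2 Z hZ)⟩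
  | mul X Y _ _ hX hY =>
    exact ⟨hX.2 Y hY.1, fun Z hZ => by rw [mul_assoc]; exact hX.2 _ (hY.2 Z hZ)⟩
  | smul r X _ hX =>
    exact ⟨T.smul_mem r hX.1, fun Z hZ => by
      rw [smul_mul_assoc]; exact T.smul_mem r (hX.2 Z hZ)⟩

variable {A B}

theorem generates_of_span_wordValues_eq_top {m : ℕ}
    (h : Submodule.span R (wordValues A B m) = ⊤) : Generates R A B := by
  refine eq_top_iff.2 fun X _ => ?_
  have hle : Submodule.span R (wordValues A B m) ≤
      (NonUnitalAlgebra.adjoin R ({A, B} : Set (Matrix (Fin n) (Fin n) R))).toSubmodule :=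
    Submodule.span_le.2 (wordValues_subset_adjoin A B m)
  exact hle (h ▸ Submodule.mem_top)

theorem Generates.not_commute [Nontrivial R] (hn : 2 ≤ n) (h : Generates R A B) :
    ¬ Commute A B := by
  intro hAB
  have hcent : ∀ X Y : Matrix (Fin n) (Fin n) R, Commute X Y := by
    have hgen : ∀ Z : Matrix (Fin n) (Fin n) R, Commute A Z → Commute B Z →
        ∀ X, Commute X Z := by
      intro Z hA hB X
      have hX : X ∈ NonUnitalAlgebra.adjoin R ({A, B} : Set (Matrix (Fin n) (Fin n) R)) := by
        rw [show NonUnitalAlgebra.adjoin R ({A, B} : Set (Matrix (Fin n) (Fin n) R)) = ⊤ from h]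
        trivial
      induction hX using NonUnitalAlgebra.adjoin_induction with
      | mem X hX => rcases hX with rfl | rfl <;> assumption
      | zero => exact Commute.zero_left Z
      | add X Y _ _ hX hY => exact hX.add_left hY
      | mul X Y _ _ hX hY => exact hX.mul_left hY
      | smul r X _ hX => exact hX.smul_left r
    exact fun X Y => hgen Y (hgen A (Commute.refl A) hAB.symm Y).symm
      (hgen B hAB (Commute.refl B) Y).symm X
  let i : Fin n := ⟨0, by omega⟩
  let j : Fin n := ⟨1, by omega⟩
  have hij : i ≠ j := by simp [i, j]
  have := congrFun (congrFun (hcent (Matrix.single i j 1) (Matrix.single j i 1)).eq i) i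
  simp [hij] at this

theorem Generates.map {S : Type*} [CommRing S] {f : R →+* S} (hf : Function.Surjective f)
    (h : Generates R A B) : Generates S (f.mapMatrix A) (f.mapMatrix B) := by
  refine eq_top_iff.2 fun X _ => ?_
  obtain ⟨Y, rfl⟩ : ∃ Y, f.mapMatrix Y = X := by
    choose g hg using hf
    exact ⟨X.map g, by ext; simp [hg]⟩
  have hY : Y ∈ NonUnitalAlgebra.adjoin R ({A, B} : Set (Matrix (Fin n) (Fin n) R)) := by
    rw [show NonUnitalAlgebra.adjoin R ({A, B} : Set (Matrix (Fin n) (Fin n) R)) = ⊤ from h]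
    trivial
  induction hY using NonUnitalAlgebra.adjoin_induction with
  | mem Y hY =>
    apply NonUnitalAlgebra.subset_adjoin
    rcases hY with rfl | rfl <;> simp
  | zero => rw [map_zero]; exact zero_mem _
  | add X Y _ _ hX hY => rw [map_add]; exact add_mem (hX trivial) (hY trivial)
  | mul X Y _ _ hX hY => rw [map_mul]; exact mul_mem (hX trivial) (hY trivial)
  | smul r X _ hX =>
    rw [show f.mapMatrix (r • X) = f r • f.mapMatrix X by ext; simp]
    exact SMulMemClass.smul_mem _ (hX trivial)

theorem exists_mem_span_wordValues_mapMatrix_eq {S : Type*} [CommRing S] {f : R →+* S}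
    (hf : Function.Surjective f) {m : ℕ} {X : Matrix (Fin n) (Fin n) S}
    (hX : X ∈ Submodule.span S (wordValues (f.mapMatrix A) (f.mapMatrix B) m)) :
    ∃ Y ∈ Submodule.span R (wordValues A B m), f.mapMatrix Y = X := by
  induction hX using Submodule.span_induction with
  | mem X hX =>
    obtain ⟨w, hw, hl, rfl⟩ := hX
    refine ⟨_, Submodule.subset_span ⟨w, hw, hl, rfl⟩, ?_⟩
    rw [map_list_prod, List.map_map]
    congr 2
    ext1 i
    exact apply_ite f.mapMatrix _ _ _
  | zero => exact ⟨0, zero_mem _, map_zero _⟩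
  | add X Y _ _ hX hY =>
    obtain ⟨X, hX, rfl⟩ := hX
    obtain ⟨Y, hY, rfl⟩ := hY
    exact ⟨X + Y, add_mem hX hY, map_add _ _ _⟩
  | smul s X _ hX =>
    obtain ⟨X, hX, rfl⟩ := hX
    obtain ⟨r, rfl⟩ := hf s
    exact ⟨r • X, Submodule.smul_mem _ r hX, by ext; simp⟩

end Words

theorem Generates.linearIndependent {n : ℕ} {K : Type*} [Field K]
    {A B : Matrix (Fin n) (Fin n) K} (hn : 2 ≤ n) (h : Generates K A B) :
    LinearIndependent K ![A, B] := by
  by_contra hdep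
  rw [LinearIndependent.pair_iff] at hdep
  push Not at hdep
  obtain ⟨s, t, hst, hne⟩ := hdep
  apply h.not_commute hn
  by_cases hs : s = 0
  · have ht := hne hs
    have hB : B = 0 := by simpa [hs, ht] using hst
    exact hB ▸ Commute.zero_right A
  · have hA : A = (-(s⁻¹ * t)) • B := by
      rw [neg_smul, mul_smul, ← smul_neg, ← eq_neg_of_add_eq_zero_left hst, smul_smul,
        inv_mul_cancel₀ hs, one_smul]
    rw [hA]
    exact (Commute.refl B).smul_left _

theorem Generates.span_wordValues_eq_top_of_field {n : ℕ} {K : Type*} [Field K]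
    {A B : Matrix (Fin n) (Fin n) K} (hn : 2 ≤ n) (h : Generates K A B) :
    Submodule.span K (wordValues A B (n ^ 2 - 1)) = ⊤ := by
  have key : ∀ m, 1 ≤ m → Submodule.span K (wordValues A B m) = ⊤ ∨
      m + 1 ≤ Module.finrank K (Submodule.span K (wordValues A B m)) := by
    intro m hm
    induction m, hm using Nat.le_induction with
    | base =>
      right
      have h2 := finrank_span_eq_card (h.linearIndependent hn)
      rw [Matrix.range_cons, Matrix.range_cons, Matrix.range_empty, Set.union_empty,
        Set.singleton_union, Fintype.card_fin] at h2
      rw [one_add_one_eq_two]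
      exact h2.ge.trans <| Submodule.finrank_mono <| Submodule.span_mono <|
        pair_subset_wordValues A B le_rfl
    | succ m hm ih =>
      have hle := Submodule.span_mono (R := K) (wordValues_mono A B (Nat.le_add_right m 1))
      by_cases hstep : Submodule.span K (wordValues A B (m + 1)) ≤
          Submodule.span K (wordValues A B m)
      · left
        refine eq_top_iff.2 fun X _ => hle (mem_span_wordValues_of_mem_adjoin A B hm hstep ?_)
        rw [show NonUnitalAlgebra.adjoin K ({A, B} : Set (Matrix (Fin n) (Fin n) K)) = ⊤ from h]
        trivial
      · rcases ih with ih | ih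
        · exact absurd (ih ▸ le_top) hstep
        · right
          have := Submodule.finrank_lt_finrank_of_lt (lt_of_le_not_ge hle hstep)
          omega
  have hn2 : 2 ^ 2 ≤ n ^ 2 := Nat.pow_le_pow_left hn 2
  refine (key (n ^ 2 - 1) (by omega)).elim id fun hrank => ?_
  apply Submodule.eq_top_of_finrank_eq
  apply le_antisymm (Submodule.finrank_le _)
  rw [Module.finrank_matrix, Fintype.card_fin, Module.finrank_self, mul_one, ← sq]
  omega

theorem Generates.span_wordValues_eq_top {n : ℕ} {R : Type*} [CommRing R]
    {A B : Matrix (Fin n) (Fin n) R} (hn : 2 ≤ n) (h : Generates R A B) :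
    Submodule.span R (wordValues A B (n ^ 2 - 1)) = ⊤ := by
  obtain htop | ⟨P, hP, hNP⟩ := eq_top_or_exists_le_coatom
    (Submodule.span R (wordValues A B (n ^ 2 - 1)))
  · exact htop
  refine absurd (eq_top_iff.2 fun X _ => ?_) hP.1
  have : IsSimpleModule R (Matrix (Fin n) (Fin n) R ⧸ P) := isSimpleModule_iff_isCoatom.2 hP
  let I := Module.annihilator R (Matrix (Fin n) (Fin n) R ⧸ P)
  have hI : I.IsMaximal := IsSimpleModule.annihilator_isMaximal
  let _ : Field (R ⧸ I) := Ideal.Quotient.field I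
  have hf : Function.Surjective (Ideal.Quotient.mk I) := Ideal.Quotient.mk_surjective
  have hX : (Ideal.Quotient.mk I).mapMatrix X ∈ Submodule.span (R ⧸ I) (wordValues
      ((Ideal.Quotient.mk I).mapMatrix A) ((Ideal.Quotient.mk I).mapMatrix B) (n ^ 2 - 1)) := by
    rw [(h.map hf).span_wordValues_eq_top_of_field hn]
    trivial
  obtain ⟨Y, hY, hXY⟩ := exists_mem_span_wordValues_mapMatrix_eq hf hX
  have hdiff : X - Y ∈ P := by
    rw [Matrix.matrix_eq_sum_single (X - Y)]
    refine sum_mem fun i _ => sum_mem fun j _ => ?_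
    have hentry : (X - Y) i j ∈ I := by
      rw [← Ideal.Quotient.eq_zero_iff_mem, Matrix.sub_apply, map_sub, sub_eq_zero]
      exact (congrFun (congrFun hXY i) j).symm
    rw [← mul_one ((X - Y) i j), ← smul_eq_mul, ← Matrix.smul_single,
      ← Submodule.Quotient.mk_eq_zero, Submodule.Quotient.mk_smul]
    exact Module.mem_annihilator.1 hentry _
  simpa using P.add_mem hdiff (hNP hY)

theorem stmt_2 (n : ℕ) (hn : 2 ≤ n) (A B : Matrix (Fin n) (Fin n) ℤ) :
    Generates ℤ A B ↔ Submodule.span ℤ (wordValues A B (n ^ 2 - 1)) = ⊤ :=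
  ⟨fun h => h.span_wordValues_eq_top hn, generates_of_span_wordValues_eq_top⟩
end

section
/- Fix n ≥ 2. For every real ε > 0 there exists N such that for every finite field F with #F ≥ N, the number of pairs (A,B) of n×n matrices over F that generate M_n(F) is at least (1 − ε)·(#F)^{2n²}. Equivalently, #G_n(F_q)/#(M_n(F_q)²) → 1 as q → ∞. -/
/-- The determinant of the `n² × n²` matrix whose rows are the entries of the words
`B ^ (i + 1) * A * B ^ (j + 1)`, for `i, j < n`. -/
def wordDet {n : ℕ} {R : Type*} [CommRing R] (A B : Matrix (Fin n) (Fin n) R) : R :=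
  Matrix.det (Matrix.of fun p q : Fin n × Fin n =>
    (B ^ ((p.1 : ℕ) + 1) * A * B ^ ((p.2 : ℕ) + 1)) q.1 q.2)

theorem map_wordDet {n : ℕ} {R S : Type*} [CommRing R] [CommRing S] (f : R →+* S)
    (A B : Matrix (Fin n) (Fin n) R) :
    f (wordDet A B) = wordDet (f.mapMatrix A) (f.mapMatrix B) := by
  unfold wordDet
  rw [RingHom.map_det]
  congr 1
  ext p q
  simp only [← map_pow, ← map_mul]
  rfl

theorem generates_of_isUnit_wordDet {n : ℕ} {R : Type*} [CommRing R]
    {A B : Matrix (Fin n) (Fin n) R} (h : IsUnit (wordDet A B)) : Generates R A B := by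
  unfold Generates
  rw [eq_top_iff]
  intro C _
  set M := Matrix.of fun p q : Fin n × Fin n =>
    (B ^ ((p.1 : ℕ) + 1) * A * B ^ ((p.2 : ℕ) + 1)) q.1 q.2 with hM
  have hC : C = ∑ p : Fin n × Fin n, (Matrix.vecMul (fun q => C q.1 q.2) M⁻¹) p •
      (B ^ ((p.1 : ℕ) + 1) * A * B ^ ((p.2 : ℕ) + 1)) := by
    have key : Matrix.vecMul (Matrix.vecMul (fun q : Fin n × Fin n => C q.1 q.2) M⁻¹) M =
        fun q => C q.1 q.2 := by
      rw [Matrix.vecMul_vecMul, Matrix.nonsing_inv_mul _ h, Matrix.vecMul_one]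
    ext i j
    rw [Matrix.sum_apply]
    exact (congrFun key (i, j)).symm
  have hA : A ∈ NonUnitalAlgebra.adjoin R ({A, B} : Set (Matrix (Fin n) (Fin n) R)) :=
    NonUnitalAlgebra.subset_adjoin R (by simp)
  have hB : B ∈ NonUnitalAlgebra.adjoin R ({A, B} : Set (Matrix (Fin n) (Fin n) R)) :=
    NonUnitalAlgebra.subset_adjoin R (by simp)
  have hpow : ∀ k : ℕ,
      B ^ (k + 1) ∈ NonUnitalAlgebra.adjoin R ({A, B} : Set (Matrix (Fin n) (Fin n) R)) := by
    intro k
    induction k with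
    | zero => simpa using hB
    | succ k ih => rw [pow_succ]; exact mul_mem ih hB
  rw [hC]
  exact sum_mem fun p _ => SMulMemClass.smul_mem _ (mul_mem (mul_mem (hpow _) hA) (hpow _))

/-- The permutation matrix of the cyclic shift `j ↦ j + 1` on `Fin n`. -/
def cyclicShift (n : ℕ) [NeZero n] (R : Type*) [CommRing R] : Matrix (Fin n) (Fin n) R :=
  Matrix.of fun i j => if i = j + 1 then 1 else 0

theorem cyclicShift_apply {n : ℕ} [NeZero n] {R : Type*} [CommRing R] (i j : Fin n) :
    cyclicShift n R i j = if i = j + 1 then 1 else 0 :=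
  rfl

open scoped Fin.CommRing in
theorem cyclicShift_pow_apply {n : ℕ} [NeZero n] {R : Type*} [CommRing R] (k : ℕ) (i j : Fin n) :
    (cyclicShift n R ^ k) i j = if i = j + (k : Fin n) then 1 else 0 := by
  induction k generalizing i j with
  | zero => simp [Matrix.one_apply]
  | succ k ih =>
    rw [pow_succ, Matrix.mul_apply]
    simp only [ih, cyclicShift_apply, mul_ite, mul_one, mul_zero, Finset.sum_ite_eq',
      Finset.mem_univ, if_true, Nat.cast_add, Nat.cast_one]
    rw [add_assoc, add_comm 1]

open scoped Fin.CommRing in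
theorem isUnit_wordDet_single_cyclicShift (n : ℕ) [NeZero n] (R : Type*) [CommRing R] :
    IsUnit (wordDet (Matrix.single 0 0 1) (cyclicShift n R)) := by
  let σ : Equiv.Perm (Fin n × Fin n) :=
    Equiv.prodCongr (Equiv.addRight 1) ((Equiv.addRight 1).trans (Equiv.neg (Fin n)))
  have h : (Matrix.of fun p q : Fin n × Fin n =>
      (cyclicShift n R ^ ((p.1 : ℕ) + 1) * Matrix.single 0 0 1 *
        cyclicShift n R ^ ((p.2 : ℕ) + 1) : Matrix (Fin n) (Fin n) R) q.1 q.2) =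
      (1 : Matrix (Fin n × Fin n) (Fin n × Fin n) R).submatrix σ id := by
    ext ⟨a, b⟩ ⟨i, j⟩
    have hj : (0 = j + (b + 1)) ↔ -(b + 1) = j := by
      rw [eq_comm, add_eq_zero_iff_eq_neg, eq_comm]
    rw [Matrix.of_apply, Matrix.mul_apply, Finset.sum_eq_single 0]
    · simp [cyclicShift_pow_apply, Matrix.one_apply, σ, hj, ite_and, eq_comm (a := i)]
      split_ifs <;> rfl
    · intro k _ hk
      simp [hk]
    · simp
  unfold wordDet
  rw [h, Matrix.det_permute, Matrix.det_one, mul_one]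
  exact (Units.isUnit _).map (Int.castRingHom R)

theorem stmt_10 (n : ℕ) (hn : 2 ≤ n) :
    ∀ ε : ℝ, 0 < ε → ∃ N : ℕ, ∀ (F : Type) [Field F] [Fintype F], N ≤ Fintype.card F →
      (1 - ε) * (Fintype.card F : ℝ) ^ (2 * n ^ 2) ≤
        ({ p : Matrix (Fin n) (Fin n) F × Matrix (Fin n) (Fin n) F |
            Generates F p.1 p.2 }.ncard : ℝ) := by
  classical
  intro ε hε
  have : NeZero n := ⟨by omega⟩
  let e : Bool × Fin n × Fin n ≃ Fin (2 * n ^ 2) :=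
    Fintype.equivFinOfCardEq (by simp [sq])
  let P : MvPolynomial (Fin (2 * n ^ 2)) ℤ :=
    wordDet (Matrix.of fun i j : Fin n => .X (e (false, i, j)))
      (Matrix.of fun i j : Fin n => .X (e (true, i, j)))
  obtain ⟨N, hN⟩ := exists_nat_gt ((P.totalDegree : ℝ) / ε)
  refine ⟨N, fun F _ _ hF => ?_⟩
  let m : (Fin (2 * n ^ 2) → F) ≃ Matrix (Fin n) (Fin n) F × Matrix (Fin n) (Fin n) F :=
    { toFun := fun f =>
        (Matrix.of fun i j => f (e (false, i, j)), Matrix.of fun i j => f (e (true, i, j)))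
      invFun := fun p k =>
        bif (e.symm k).1 then p.2 (e.symm k).2.1 (e.symm k).2.2
        else p.1 (e.symm k).2.1 (e.symm k).2.2
      left_inv := fun f => by
        ext k
        obtain ⟨⟨b, i, j⟩, rfl⟩ := e.surjective k
        cases b <;> simp
      right_inv := fun p => by ext <;> simp }
  set Q := MvPolynomial.map (Int.castRingHom F) P with hQ
  have hev : ∀ f, MvPolynomial.eval f Q = wordDet (m f).1 (m f).2 := by
    intro f
    rw [hQ, MvPolynomial.eval_map]
    change MvPolynomial.eval₂Hom (Int.castRingHom F) f P = _
    simp only [P]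
    rw [map_wordDet]
    congr 1 <;> ext i j <;> simp [m]
  have hQ0 : Q ≠ 0 := by
    intro h0
    have := hev (m.symm (Matrix.single 0 0 1, cyclicShift n F))
    rw [h0, map_zero, Equiv.apply_symm_apply] at this
    exact (isUnit_wordDet_single_cyclicShift n F).ne_zero this.symm
  have hdeg : Q.totalDegree ≤ P.totalDegree :=
    Finset.sup_mono (MvPolynomial.support_map_subset _ _)
  have hq : (0 : ℝ) < Fintype.card F := by exact_mod_cast Fintype.card_pos
  have hsz := MvPolynomial.schwartz_zippel_totalDegree hQ0 (Finset.univ : Finset F)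
  rw [Fintype.piFinset_univ, Finset.card_univ] at hsz
  set Z := Finset.univ.filter fun f => MvPolynomial.eval f Q = 0 with hZ
  have hZle : (Z.card : ℝ) ≤ ε * (Fintype.card F : ℝ) ^ (2 * n ^ 2) := by
    have h1 : (Z.card : ℝ) / (Fintype.card F : ℝ) ^ (2 * n ^ 2) ≤
        (Q.totalDegree : ℝ) / Fintype.card F := by
      have := (NNRat.cast_le (K := ℝ)).2 hsz
      push_cast at this
      exact this
    rw [← div_le_iff₀ (by positivity)]
    refine h1.trans ?_
    rw [div_lt_iff₀ hε] at hN
    rw [div_le_iff₀ hq]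
    have h2 : (Q.totalDegree : ℝ) ≤ P.totalDegree := by exact_mod_cast hdeg
    have h3 : (N : ℝ) ≤ Fintype.card F := by exact_mod_cast hF
    nlinarith
  have hcard : Z.card + Zᶜ.card = Fintype.card F ^ (2 * n ^ 2) := by
    rw [Finset.card_add_card_compl, Fintype.card_fun, Fintype.card_fin]
  have hle : Zᶜ.card ≤ { p : Matrix (Fin n) (Fin n) F × Matrix (Fin n) (Fin n) F |
      Generates F p.1 p.2 }.ncard := by
    rw [← Set.ncard_coe_finset, ← Set.ncard_image_of_injective _ m.injective]
    refine Set.ncard_le_ncard ?_ (Set.toFinite _)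
    rintro _ ⟨f, hf, rfl⟩
    have hf' : MvPolynomial.eval f Q ≠ 0 := by simpa [hZ] using hf
    rw [hev] at hf'
    exact generates_of_isUnit_wordDet hf'.isUnit
  have hcard' : (Z.card : ℝ) + Zᶜ.card = (Fintype.card F : ℝ) ^ (2 * n ^ 2) := by
    exact_mod_cast hcard
  have hle' : (Zᶜ.card : ℝ) ≤ ({ p : Matrix (Fin n) (Fin n) F × Matrix (Fin n) (Fin n) F |
      Generates F p.1 p.2 }.ncard : ℝ) := by exact_mod_cast hle
  linarith
end

section
/- Let n ≥ 2. The kernel of the surjective ring homomorphism φ_n : ℤ⟨x,y⟩ → M_n(ℤ) determined by φ_n(x) = X and φ_n(y) = Y equals the two-sided ideal of ℤ⟨x,y⟩ generated by the elements r_{1,n} = xⁿ − 1, r_{2,n} = (Σ_{i=0}^{n−1} x^{n−i} y x^i) − 1, s_0 = y² − y, and s_k = y x^k y for 1 ≤ k ≤ ⌊n/2⌋. In particular M_n(ℤ) ≅ ℤ⟨x,y⟩ / (r_{1,n}, r_{2,n}, s_0, s_1, …, s_{⌊n/2⌋}). -/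
/-- The `n × n` cyclic permutation matrix `X = E₂₁ + E₃₂ + ⋯ + E_{n,n-1} + E_{1n}`,
with `X i j = 1` iff `i ≡ j + 1 (mod n)`. -/
def Xmat (n : ℕ) : Matrix (Fin n) (Fin n) ℤ :=
  Matrix.of fun i j => if (i : ℕ) = ((j : ℕ) + 1) % n then 1 else 0

/-- The matrix unit `Y = E₁₁`. -/
def Ymat (n : ℕ) : Matrix (Fin n) (Fin n) ℤ :=
  Matrix.of fun i j => if (i : ℕ) = 0 ∧ (j : ℕ) = 0 then 1 else 0

/-- The generator `x` of the free ring `ℤ⟨x,y⟩ = FreeAlgebra ℤ (Fin 2)`. -/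
noncomputable def fx : FreeAlgebra ℤ (Fin 2) := FreeAlgebra.ι ℤ 0

/-- The generator `y` of the free ring `ℤ⟨x,y⟩ = FreeAlgebra ℤ (Fin 2)`. -/
noncomputable def fy : FreeAlgebra ℤ (Fin 2) := FreeAlgebra.ι ℤ 1

/-- The ring homomorphism `φₙ : ℤ⟨x,y⟩ → Mₙ(ℤ)` sending `x ↦ X`, `y ↦ Y`. -/
noncomputable def phi (n : ℕ) : FreeAlgebra ℤ (Fin 2) →ₐ[ℤ] Matrix (Fin n) (Fin n) ℤ :=
  FreeAlgebra.lift ℤ ![Xmat n, Ymat n]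

/-- `r_{1,n} = xⁿ - 1`. -/
noncomputable def r1 (n : ℕ) : FreeAlgebra ℤ (Fin 2) := fx ^ n - 1

/-- `r_{2,n} = (Σ_{i=0}^{n-1} x^{n-i} y x^i) - 1`. -/
noncomputable def r2 (n : ℕ) : FreeAlgebra ℤ (Fin 2) :=
  (∑ i ∈ Finset.range n, fx ^ (n - i) * fy * fx ^ i) - 1

/-- `s₀ = y² - y`. -/
noncomputable def s0 : FreeAlgebra ℤ (Fin 2) := fy ^ 2 - fy

/-- `s_j = y x^j y`. -/
noncomputable def s (j : ℕ) : FreeAlgebra ℤ (Fin 2) := fy * fx ^ j * fy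

theorem Xmat_pow_apply {n : ℕ} (k : ℕ) (a b : Fin n) :
    (Xmat n ^ k) a b = if (a : ℕ) = ((b : ℕ) + k) % n then 1 else 0 := by
  induction k generalizing b with
  | zero => simp [Matrix.one_apply, Fin.ext_iff, Nat.mod_eq_of_lt b.2]
  | succ k ih =>
    have hn : 0 < n := b.pos
    rw [pow_succ, Matrix.mul_apply,
      Finset.sum_eq_single (⟨((b : ℕ) + 1) % n, Nat.mod_lt _ hn⟩ : Fin n)]
    · rw [ih]
      simp [Xmat, Nat.add_assoc, Nat.add_comm 1 k]
    · intro c _ hc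
      have : ¬ (c : ℕ) = ((b : ℕ) + 1) % n := fun h => hc (Fin.ext h)
      simp [Xmat, this]
    · simp

theorem Xmat_pow_card (n : ℕ) : Xmat n ^ n = 1 := by
  ext a b
  simp [Xmat_pow_apply, Matrix.one_apply, Fin.ext_iff, Nat.mod_eq_of_lt b.2]

theorem Ymat_eq_single (n : ℕ) [NeZero n] : Ymat n = Matrix.single 0 0 1 := by
  ext a b
  simp only [Ymat, Matrix.of_apply, Matrix.single_apply, Fin.ext_iff, Fin.val_zero,
    eq_comm (a := 0)]

theorem mul_Ymat_mul_apply {n : ℕ} [NeZero n] (A B : Matrix (Fin n) (Fin n) ℤ) (a b : Fin n) :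
    (A * Ymat n * B) a b = A a 0 * B 0 b := by
  rw [Ymat_eq_single, Matrix.mul_apply, Finset.sum_eq_single 0]
  · simp
  · intro c _ hc
    simp [Matrix.mul_single_apply_of_ne, hc]
  · simp

theorem Ymat_mul_mul_Ymat {n : ℕ} [NeZero n] (A : Matrix (Fin n) (Fin n) ℤ) :
    Ymat n * A * Ymat n = A 0 0 • Ymat n := by
  rw [Ymat_eq_single, Matrix.single_mul_mul_single]
  simp

theorem Xmat_pow_mul_Ymat_mul_Xmat_pow {n : ℕ} [NeZero n] (i j : Fin n) :
    Xmat n ^ (i : ℕ) * Ymat n * Xmat n ^ (n - j : ℕ) = Matrix.single i j 1 := by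
  ext a b
  rw [mul_Ymat_mul_apply, Xmat_pow_apply, Xmat_pow_apply, Matrix.single_apply]
  have hi := i.2
  have hj := j.2
  have hb := b.2
  have h : 0 = ((b : ℕ) + (n - j)) % n ↔ j = b := by
    rw [Fin.ext_iff]
    rcases lt_or_ge (b : ℕ) j with h | h
    · rw [Nat.mod_eq_of_lt (by omega)]; omega
    · rw [show (b : ℕ) + (n - j) = (b - j) + n by omega, Nat.add_mod_right,
        Nat.mod_eq_of_lt (by omega)]
      omega
  have h' : (a : ℕ) = (((0 : Fin n) : ℕ) + i) % n ↔ i = a := by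
    rw [Fin.val_zero, Nat.zero_add, Nat.mod_eq_of_lt hi, Fin.ext_iff, eq_comm]
  rw [if_congr h' rfl rfl, Fin.val_zero, if_congr h rfl rfl]
  by_cases h1 : i = a <;> by_cases h2 : j = b <;> simp [h1, h2]

section Ring

variable {R : Type*} [Ring R]

/-- The additive map `Mₙ(ℤ) → R` sending the matrix unit `E_{ij}` to `x ^ i * y * x ^ (n - j)`. -/
def ofMatrix (n : ℕ) (x y : R) (M : Matrix (Fin n) (Fin n) ℤ) : R :=
  ∑ j, ∑ i, M i j • (x ^ (i : ℕ) * y * x ^ (n - j : ℕ))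

theorem ofMatrix_one (n : ℕ) (x y : R) :
    ofMatrix n x y 1 = ∑ i ∈ Finset.range n, x ^ i * y * x ^ (n - i) := by
  rw [← Fin.sum_univ_eq_sum_range (fun i => x ^ i * y * x ^ (n - i))]
  simp [ofMatrix, Matrix.one_apply, ite_smul]

theorem ofMatrix_add (n : ℕ) (x y : R) (M N : Matrix (Fin n) (Fin n) ℤ) :
    ofMatrix n x y (M + N) = ofMatrix n x y M + ofMatrix n x y N := by
  simp [ofMatrix, add_smul, Finset.sum_add_distrib]

theorem ofMatrix_zsmul (n : ℕ) (x y : R) (c : ℤ) (M : Matrix (Fin n) (Fin n) ℤ) :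
    ofMatrix n x y (c • M) = c • ofMatrix n x y M := by
  simp [ofMatrix, mul_smul, Finset.smul_sum]

theorem ofMatrix_mul {n : ℕ} {x y p : R} {P : Matrix (Fin n) (Fin n) ℤ}
    (h : ∀ k, ∑ i, P i k • (x ^ (i : ℕ) * y) = p * (x ^ (k : ℕ) * y))
    (M : Matrix (Fin n) (Fin n) ℤ) : ofMatrix n x y (P * M) = p * ofMatrix n x y M := by
  simp only [ofMatrix, Finset.mul_sum]
  refine Finset.sum_congr rfl fun j _ => ?_
  simp only [Matrix.mul_apply, Finset.sum_smul]
  rw [Finset.sum_comm]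
  refine Finset.sum_congr rfl fun k _ => ?_
  rw [mul_smul_comm, ← mul_assoc, ← h, Finset.sum_mul, Finset.smul_sum]
  refine Finset.sum_congr rfl fun i _ => ?_
  rw [smul_mul_assoc, smul_smul, mul_comm]

theorem sum_conj_reflect {n : ℕ} {x : R} (y : R) (hx : x ^ n = 1) :
    ∑ i ∈ Finset.range n, x ^ i * y * x ^ (n - i) =
      ∑ i ∈ Finset.range n, x ^ (n - i) * y * x ^ i := by
  cases n with
  | zero => simp
  | succ m =>
    rw [Finset.sum_range_succ', Finset.sum_range_succ', ← Finset.sum_range_reflect]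
    congr 1
    · refine Finset.sum_congr rfl fun i hi => ?_
      have := Finset.mem_range.1 hi
      rw [show m - 1 - i + 1 = m + 1 - (i + 1) by omega,
        show m + 1 - (m + 1 - (i + 1)) = i + 1 by omega]
    · simp [hx]

/-- If the conjugates of an idempotent `y` by powers of `x` sum to `1` and `y * x ^ k * y` vanishes
for `1 ≤ k ≤ n / 2`, then it vanishes for all `1 ≤ k < n`. -/
theorem mul_pow_mul_eq_zero {n : ℕ} {x y : R} (hx : x ^ n = 1)
    (hsum : ∑ i ∈ Finset.range n, x ^ (n - i) * y * x ^ i = 1) (hy : y * y = y)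
    (hs : ∀ k, 1 ≤ k → k ≤ n / 2 → y * x ^ k * y = 0) {k : ℕ} (hk : 1 ≤ k) (hkn : k < n) :
    y * x ^ k * y = 0 := by
  suffices H : ∀ j, 1 ≤ j → j < n → y * x ^ (n - j) * y = 0 by
    simpa [Nat.sub_sub_self hkn.le] using H (n - k) (by omega) (by omega)
  intro j
  induction j using Nat.strong_induction_on with
  | _ j ih =>
    intro hj hjn
    have key : ∑ i ∈ Finset.range n, (y * x ^ (n - i) * y) * (x ^ (i + (n - j)) * y) =
        y * x ^ (n - j) * y := by
      calc _ = y * (∑ i ∈ Finset.range n, x ^ (n - i) * y * x ^ i) * (x ^ (n - j) * y) := by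
            rw [Finset.mul_sum, Finset.sum_mul]
            refine Finset.sum_congr rfl fun i _ => ?_
            rw [pow_add]
            simp only [mul_assoc]
        _ = _ := by rw [hsum]; simp only [mul_one, mul_assoc]
    have hpair : ∑ i ∈ Finset.range n, (y * x ^ (n - i) * y) * (x ^ (i + (n - j)) * y) =
        ∑ i ∈ ({0, j} : Finset ℕ), (y * x ^ (n - i) * y) * (x ^ (i + (n - j)) * y) := by
      symm
      refine Finset.sum_subset ?_ ?_
      · intro i hi
        simp only [Finset.mem_insert, Finset.mem_singleton] at hi
        rw [Finset.mem_range]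
        omega
      · intro i hi hi'
        simp only [Finset.mem_insert, Finset.mem_singleton, not_or] at hi'
        rw [Finset.mem_range] at hi
        by_cases hij : i < j
        · rw [ih i hij (by omega) hi, zero_mul]
        by_cases hsmall : i - j ≤ n / 2
        · rw [show i + (n - j) = (i - j) + n by omega, pow_add, hx, mul_one, mul_assoc (y * _),
            ← mul_assoc y (x ^ (i - j)), hs _ (by omega) hsmall, mul_zero]
        · rw [hs (n - i) (by omega) (by omega), zero_mul]
    rw [hpair, Finset.sum_pair (by omega), Nat.sub_zero, hx, mul_one, hy, Nat.zero_add,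
      Nat.add_sub_cancel' hjn.le, hx, one_mul, mul_assoc _ y y, hy, ← mul_assoc] at key
    simpa using key

theorem sum_Xmat_smul {n : ℕ} {x : R} (y : R) (hx : x ^ n = 1) (k : Fin n) :
    ∑ i, Xmat n i k • (x ^ (i : ℕ) * y) = x * (x ^ (k : ℕ) * y) := by
  rw [Finset.sum_eq_single (⟨((k : ℕ) + 1) % n, Nat.mod_lt _ k.pos⟩ : Fin n)]
  · simp only [Xmat, Matrix.of_apply, if_true, one_smul]
    rw [← mul_assoc, ← pow_succ', ← pow_eq_pow_mod _ hx]
  · intro c _ hc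
    have : ¬ (c : ℕ) = ((k : ℕ) + 1) % n := fun h => hc (Fin.ext h)
    simp [Xmat, this]
  · simp

theorem sum_Ymat_smul {n : ℕ} [NeZero n] {x y : R} (hy : y * y = y)
    (hs : ∀ k, 1 ≤ k → k < n → y * x ^ k * y = 0) (k : Fin n) :
    ∑ i, Ymat n i k • (x ^ (i : ℕ) * y) = y * (x ^ (k : ℕ) * y) := by
  rw [Finset.sum_eq_single 0]
  · by_cases hk : k = 0
    · simp [Ymat, hk, hy]
    · have : (k : ℕ) ≠ 0 := fun h => hk (Fin.ext h)
      rw [← mul_assoc, hs k (by omega) k.2]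
      simp [Ymat, hk]
  · intro c _ hc
    simp [Ymat, hc]
  · simp

/-- A ring homomorphism out of `ℤ⟨x,y⟩` whose values on the generators satisfy the defining
relations factors through `phi n`. -/
theorem eq_ofMatrix_phi {n : ℕ} [NeZero n] (f : FreeAlgebra ℤ (Fin 2) →+* R)
    (hx : f fx ^ n = 1) (hsum : ∑ i ∈ Finset.range n, f fx ^ (n - i) * f fy * f fx ^ i = 1)
    (hy : f fy * f fy = f fy)
    (hs : ∀ k, 1 ≤ k → k ≤ n / 2 → f fy * f fx ^ k * f fy = 0) (a : FreeAlgebra ℤ (Fin 2)) :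
    f a = ofMatrix n (f fx) (f fy) (phi n a) := by
  have H : ∀ M, ofMatrix n (f fx) (f fy) (phi n a * M) = f a * ofMatrix n (f fx) (f fy) M := by
    induction a using FreeAlgebra.induction with
    | grade0 c =>
      intro M
      rw [AlgHom.commutes, ← Algebra.smul_def, ofMatrix_zsmul]
      simp
    | grade1 i =>
      fin_cases i
      · have h : phi n (FreeAlgebra.ι ℤ 0) = Xmat n := by simp [phi]
        intro M
        change ofMatrix n _ _ (phi n (FreeAlgebra.ι ℤ 0) * M) = f fx * _
        rw [h]
        exact ofMatrix_mul (sum_Xmat_smul _ hx) M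
      · have h : phi n (FreeAlgebra.ι ℤ 1) = Ymat n := by simp [phi]
        intro M
        change ofMatrix n _ _ (phi n (FreeAlgebra.ι ℤ 1) * M) = f fy * _
        rw [h]
        exact ofMatrix_mul
          (sum_Ymat_smul hy fun k h1 h2 => mul_pow_mul_eq_zero hx hsum hy hs h1 h2) M
    | mul a b ha hb => intro M; rw [map_mul, mul_assoc, ha, hb, map_mul, mul_assoc]
    | add a b ha hb => intro M; rw [map_add, add_mul, ofMatrix_add, ha, hb, map_add, add_mul]
  have h1 := H 1
  rw [ofMatrix_one, sum_conj_reflect _ hx, hsum, mul_one, mul_one] at h1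
  exact h1.symm

end Ring

theorem ofMatrix_Xmat_Ymat {n : ℕ} [NeZero n] (M : Matrix (Fin n) (Fin n) ℤ) :
    ofMatrix n (Xmat n) (Ymat n) M = M := by
  simp only [ofMatrix, Xmat_pow_mul_Ymat_mul_Xmat_pow, Matrix.smul_single, smul_eq_mul, mul_one]
  rw [Finset.sum_comm]
  exact (Matrix.matrix_eq_sum_single M).symm

theorem phi_fx (n : ℕ) : phi n fx = Xmat n := by simp [phi, fx]

theorem phi_fy (n : ℕ) : phi n fy = Ymat n := by simp [phi, fy]

theorem phi_surjective (n : ℕ) [NeZero n] : Function.Surjective (phi n) := fun M =>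
  ⟨ofMatrix n fx fy M, by
    simpa [ofMatrix, phi_fx, phi_fy] using ofMatrix_Xmat_Ymat M⟩

theorem stmt_12 (n : ℕ) (hn : 2 ≤ n) :
    Function.Surjective (phi n) ∧
      TwoSidedIdeal.ker (phi n) =
        TwoSidedIdeal.span
          ({r1 n, r2 n, s0} ∪ { a | ∃ k, 1 ≤ k ∧ k ≤ n / 2 ∧ a = s k }) := by
  have : NeZero n := ⟨by omega⟩
  refine ⟨phi_surjective n, le_antisymm ?_ ?_⟩
  · set S : Set (FreeAlgebra ℤ (Fin 2)) :=
      {r1 n, r2 n, s0} ∪ { a | ∃ k, 1 ≤ k ∧ k ≤ n / 2 ∧ a = s k } with hS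
    set f := (TwoSidedIdeal.span S).ringCon.mk'
    have hker : ∀ a, f a = 0 ↔ a ∈ TwoSidedIdeal.span S := fun a => by
      rw [← TwoSidedIdeal.mem_ker, TwoSidedIdeal.ker_ringCon_mk']
    have hmem : ∀ a ∈ S, f a = 0 := fun a ha => (hker a).2 (TwoSidedIdeal.subset_span ha)
    intro a ha
    rw [← hker, eq_ofMatrix_phi (n := n) f, (TwoSidedIdeal.mem_ker _).1 ha]
    · simp [ofMatrix]
    · simpa [r1, sub_eq_zero] using hmem (r1 n) (by simp [hS])
    · simpa [r2, sub_eq_zero] using hmem (r2 n) (by simp [hS])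
    · simpa [s0, sub_eq_zero, sq] using hmem s0 (by simp [hS])
    · intro k h1 h2
      simpa [s] using hmem (s k) (Or.inr ⟨k, h1, h2, rfl⟩)
  · rw [TwoSidedIdeal.span_le]
    rintro a ((rfl | rfl | rfl) | ⟨k, h1, h2, rfl⟩) <;>
      rw [SetLike.mem_coe, TwoSidedIdeal.mem_ker]
    · simp [r1, phi_fx, Xmat_pow_card]
    · have h := ofMatrix_Xmat_Ymat (1 : Matrix (Fin n) (Fin n) ℤ)
      rw [ofMatrix_one, sum_conj_reflect _ (Xmat_pow_card n)] at h
      simp [r2, phi_fx, phi_fy, h]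
    · simp [s0, phi_fy, sq, Ymat_eq_single]
    · have hk : k % n ≠ 0 := by rw [Nat.mod_eq_of_lt (by omega)]; omega
      simp [s, phi_fx, phi_fy, Ymat_mul_mul_Ymat, Xmat_pow_apply, hk.symm]
end
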